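/- For every integer q ≥ 2 and every symmetric real q×q matrix D, there exists a family, indexed by the tuples (s₁,…,s_q) of integers with q+2 ≤ s_i ≤ 2q+2, of rooted quantum graphs T_{s₁,…,s_q} — that is, for each tuple a finite list of (s₁+⋯+s_q)-rooted graphs H₁,…,H_m together with real coefficients c₁,…,c_m, where in each H_t the roots are partitioned into q groups of sizes s₁,…,s_q and H_t has exactly 2q(q−1) non-root vertices — with the following property: for every q-step kernel U with parts A₁,…,A_q such that the density of each part of U is one of the diagonal entries of D and the density between each pair of distinct parts of U is one of the off-diagonal entries of D, there exists a real c₀ ≠ 0, depending only on D and U and not on the tuple (s₁,…,s_q), such that for every tuple and almost every choice of roots x, the value ∑_{t=1}^m c_t · t_x(H_t,U) is either 0 or c₀, and it is nonzero if and only if there is a permutation π of [q] such that: for each i all roots of the i-th group lie in A_{π(i)}, the density of the part A_{π(i)} equals D_{ii} for each i, and the density between A_{π(i)} and A_{π(j)} equals D_{ij} for all i ≠ j. -/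

import Mathlib

open MeasureTheory
open scoped BigOperators Classical

noncomputable section

abbrev I01 : Type := Set.Icc (0 : ℝ) 1

/-- A kernel: a bounded measurable symmetric function on `[0,1]²`. -/
structure GKernel where
  toFun : I01 → I01 → ℝ
  measurable' : Measurable (Function.uncurry toFun)
  bounded' : ∃ C : ℝ, ∀ x y, |toFun x y| ≤ C
  symm' : ∀ x y, toFun x y = toFun y x

/-- A graphon is a kernel with values in `[0,1]`. -/
def GKernel.IsGraphon (U : GKernel) : Prop :=
  ∀ x y, U.toFun x y ∈ Set.Icc (0 : ℝ) 1

/-- Homomorphism density of a finite simple graph in a kernel. -/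
def homDensity {n : ℕ} (H : SimpleGraph (Fin n)) (U : GKernel) : ℝ :=
  ∫ x : Fin n → I01,
    ∏ e ∈ (Set.toFinite H.edgeSet).toFinset,
      Sym2.lift ⟨fun u v => U.toFun (x u) (x v), fun _ _ => U.symm' _ _⟩ e

/-- Two kernels are weakly isomorphic if all homomorphism densities coincide. -/
def WeaklyIsomorphic (U U' : GKernel) : Prop :=
  ∀ (n : ℕ) (H : SimpleGraph (Fin n)), homDensity H U = homDensity H U'

/-- `A` is a partition of `[0,1]` into `q` measurable parts of positive measure
on whose pairwise products `U` is constant. -/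
def IsStepPartition (U : GKernel) {q : ℕ} (A : Fin q → Set I01) : Prop :=
  (∀ i, MeasurableSet (A i)) ∧
  (∀ i, 0 < volume (A i)) ∧
  Pairwise (fun i j => Disjoint (A i) (A j)) ∧
  (⋃ i, A i) = Set.univ ∧
  (∀ i j, ∃ c : ℝ, ∀ x ∈ A i, ∀ y ∈ A j, U.toFun x y = c)

def HasStepPartition (U : GKernel) (q : ℕ) : Prop :=
  ∃ A : Fin q → Set I01, IsStepPartition U A

/-- A `q`-step kernel: a step partition into `q` parts exists but none into `q - 1` parts. -/
def IsStepKernel (U : GKernel) (q : ℕ) : Prop :=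
  HasStepPartition U q ∧ ¬ HasStepPartition U (q - 1)

/-- The degree of a vertex `x` in a kernel. -/
def GKernel.degree (U : GKernel) (x : I01) : ℝ := ∫ y : I01, U.toFun x y

/-- Density of a rooted graph (roots `R`, non-root vertices `Fin b`) in a kernel,
for a given choice `x` of the roots. -/
def rootedDensity {R : Type} [Fintype R] {b : ℕ}
    (H : SimpleGraph (R ⊕ Fin b)) (U : GKernel) (x : R → I01) : ℝ :=
  ∫ y : Fin b → I01,
    ∏ e ∈ (Set.toFinite H.edgeSet).toFinset,
      Sym2.lift ⟨fun u v => U.toFun (Sum.elim x y u) (Sum.elim x y v),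
        fun _ _ => U.symm' _ _⟩ e

/-- `U` takes the constant value `v` on `A i × A j`. -/
def PartDensityIs (U : GKernel) {q : ℕ} (A : Fin q → Set I01) (i j : Fin q) (v : ℝ) : Prop :=
  ∀ x ∈ A i, ∀ y ∈ A j, U.toFun x y = v

/-- A set of pairwise vertex-disjoint edges. -/
def IsMatchingSet {V : Type} (S : Set (Sym2 V)) : Prop :=
  (∀ e ∈ S, ¬ e.IsDiag) ∧
  ∀ e ∈ S, ∀ f ∈ S, e ≠ f → ∀ v : V, ¬ (v ∈ e ∧ v ∈ f)

/-- The edges of `S` with both endpoints in `V_i ∪ V_j`, where `V_l` is the set of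
vertices with first coordinate `l`. -/
def EdgesIn {q : ℕ} {s : Fin q → ℕ} (S : Set (Sym2 ((l : Fin q) × Fin (s l))))
    (i j : Fin q) : Set (Sym2 ((l : Fin q) × Fin (s l))) :=
  {e ∈ S | ∀ v ∈ e, v.1 = i ∨ v.1 = j}

def zU (U : GKernel) {V : Type} (w : V → I01) (e : Sym2 V) : ℝ :=
  Sym2.lift ⟨fun u v => U.toFun (w u) (w v), fun _ _ => U.symm' _ _⟩ e

def monoF {V : Type} (S : Finset (Sym2 V)) : (Sym2 V → ℝ) → ℝ := fun z => ∏ e ∈ S, z e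

def MRep {V : Type} (E : Set (Sym2 V)) : Submodule ℝ ((Sym2 V → ℝ) → ℝ) :=
  Submodule.span ℝ {f | ∃ S : Finset (Sym2 V), (S : Set (Sym2 V)) ⊆ E ∧ f = monoF S}

lemma rep_one {V : Type} (E : Set (Sym2 V)) : (1 : (Sym2 V → ℝ) → ℝ) ∈ MRep E := by
  apply Submodule.subset_span
  exact ⟨∅, by simp, by funext z; simp [monoF]⟩

lemma rep_edge {V : Type} (E : Set (Sym2 V)) (e : Sym2 V) (he : e ∈ E) :
    (fun z => z e : (Sym2 V → ℝ) → ℝ) ∈ MRep E := by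
  apply Submodule.subset_span
  exact ⟨{e}, by simpa using he, by funext z; simp [monoF]⟩

lemma rep_mono {V : Type} {E F : Set (Sym2 V)} (h : E ⊆ F) : MRep E ≤ MRep F := by
  apply Submodule.span_mono
  rintro f ⟨S, hS, rfl⟩
  exact ⟨S, hS.trans h, rfl⟩

lemma rep_mul {V : Type} {E F : Set (Sym2 V)} (h : Disjoint E F) {f g : (Sym2 V → ℝ) → ℝ}
    (hf : f ∈ MRep E) (hg : g ∈ MRep F) : f * g ∈ MRep (E ∪ F) := by
  have := Submodule.mul_mem_mul hf hg
  unfold MRep at this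
  rw [Submodule.span_mul_span] at this
  refine Submodule.span_mono ?_ this
  rintro _ ⟨_, ⟨S, hS, rfl⟩, _, ⟨T, hT, rfl⟩, rfl⟩
  refine ⟨S ∪ T, ?_, ?_⟩
  · rw [Finset.coe_union]
    exact Set.union_subset_union hS hT
  · funext z
    have hd : Disjoint S T := by
      rw [← Finset.disjoint_coe]
      exact h.mono hS hT
    simp [monoF, Finset.prod_union hd]

lemma rep_prod {V ι : Type} (s : Finset ι) (E : ι → Set (Sym2 V))
    (hd : ∀ i j, i ≠ j → Disjoint (E i) (E j)) (f : ι → (Sym2 V → ℝ) → ℝ)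
    (hf : ∀ i, f i ∈ MRep (E i)) : (∏ i ∈ s, f i) ∈ MRep (⋃ i ∈ s, E i) := by
  induction s using Finset.induction_on with
  | empty => simpa using rep_one _
  | insert a s ha ih =>
    rw [Finset.prod_insert ha, Finset.set_biUnion_insert]
    refine rep_mul ?_ (hf a) ih
    rw [Set.disjoint_iUnion₂_right]
    intro i hi
    apply hd
    rintro rfl
    exact ha hi

lemma rep_prod' {V ι : Type} [Fintype ι] (E : ι → Set (Sym2 V))
    (hd : ∀ i j, i ≠ j → Disjoint (E i) (E j)) (f : ι → (Sym2 V → ℝ) → ℝ)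
    (hf : ∀ i, f i ∈ MRep (E i)) : (∏ i, f i) ∈ MRep (⋃ i, E i) := by
  have := rep_prod Finset.univ E hd f hf
  simpa using this

lemma rep_extract {V : Type} [Finite V] {E : Set (Sym2 V)} (hE : ∀ e ∈ E, ¬ e.IsDiag)
    {f : (Sym2 V → ℝ) → ℝ} (hf : f ∈ MRep E) :
    ∃ (m : ℕ) (H : Fin m → SimpleGraph V) (c : Fin m → ℝ), ∀ z,
      f z = ∑ t, c t * ∏ e ∈ (Set.toFinite (H t).edgeSet).toFinset, z e := by
  obtain ⟨m, c, g, rfl⟩ := Submodule.mem_span_set'.1 hf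
  choose S hS hg using fun t => (g t).2
  refine ⟨m, fun t => SimpleGraph.fromEdgeSet (S t : Set (Sym2 V)), c, fun z => ?_⟩
  simp only [Finset.sum_apply, Pi.smul_apply, smul_eq_mul]
  refine Finset.sum_congr rfl fun t _ => ?_
  rw [hg t, monoF]
  congr 1
  refine Finset.prod_congr ?_ fun _ _ => rfl
  ext e
  simp only [Set.Finite.mem_toFinset, SimpleGraph.edgeSet_fromEdgeSet, Set.mem_sdiff,
    Finset.mem_coe]
  constructor
  · intro h
    exact ⟨h, fun h' => hE e (hS t h) (by simpa using h')⟩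
  · exact fun h => h.1

lemma zU_abs_le (U : GKernel) {C : ℝ} (hC : ∀ x y, |U.toFun x y| ≤ C) {V : Type} (w : V → I01)
    (e : Sym2 V) : |zU U w e| ≤ C := by
  induction e using Sym2.ind with
  | _ u v => exact hC _ _

lemma zU_measurable (U : GKernel) {R B : Type} (x : R → I01) (e : Sym2 (R ⊕ B)) :
    Measurable (fun y : B → I01 => zU U (Sum.elim x y) e) := by
  induction e using Sym2.ind with
  | _ u v =>
    have h : ∀ u : R ⊕ B, Measurable (fun y : B → I01 => Sum.elim x y u) := by
      rintro (u | u)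
      · exact measurable_const
      · exact measurable_pi_apply u
    exact U.measurable'.comp ((h u).prodMk (h v))

lemma sum_rooted {R : Type} [Fintype R] {b m : ℕ} (H : Fin m → SimpleGraph (R ⊕ Fin b))
    (c : Fin m → ℝ) (U : GKernel) (x : R → I01) (f : (Sym2 (R ⊕ Fin b) → ℝ) → ℝ)
    (hf : ∀ z, f z = ∑ t, c t * ∏ e ∈ (Set.toFinite (H t).edgeSet).toFinset, z e) :
    ∑ t, c t * rootedDensity (H t) U x = ∫ y : Fin b → I01, f (zU U (Sum.elim x y)) := by
  simp_rw [hf]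
  rw [integral_finsetSum]
  · refine Finset.sum_congr rfl fun t _ => ?_
    rw [integral_const_mul]
    rfl
  · intro t _
    apply Integrable.const_mul
    obtain ⟨C, hC⟩ := U.bounded'
    refine Integrable.of_bound (C := ∏ e ∈ (Set.toFinite (H t).edgeSet).toFinset, C) ?_ ?_
    · exact (Finset.measurable_prod _ fun e _ => zU_measurable U x e).aestronglyMeasurable
    · refine Filter.Eventually.of_forall fun y => ?_
      rw [Real.norm_eq_abs, Finset.abs_prod]
      exact Finset.prod_le_prod (fun _ _ => abs_nonneg _) fun e _ => zU_abs_le U hC _ e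

section
variable {q n : ℕ} (D : Matrix (Fin q) (Fin q) ℝ) (hn : q ≤ n) {R B : Type} [Fintype R] [Fintype B]
  (g : R → Fin q) (core : Fin q → Fin (n + 1) → R) (jj : Fin q → Fin q → Fin q)
  (φ : B → (Fin q × Fin q) × Bool)

def cs (i : Fin q) : Fin (n + 1) := ⟨i, lt_of_lt_of_le i.2 (hn.trans (Nat.le_succ n))⟩

def sh (ε : Bool) (l : Fin (n + 1)) : Fin (n + 1) := if ε then l + 1 else l

lemma sh_inj (ε : Bool) (l k : Fin (n + 1)) (h : sh ε l = sh ε k) : l = k := by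
  unfold sh at h
  split_ifs at h
  · exact add_right_cancel h
  · exact h

def lf {V : Type} (e : Sym2 V) (β γ : ℝ) : (Sym2 V → ℝ) → ℝ := fun z => (z e - β) / (γ - β)

lemma lf_rep {V : Type} (E : Set (Sym2 V)) (e : Sym2 V) (he : e ∈ E) (β γ : ℝ) :
    lf e β γ ∈ MRep E := by
  have : lf e β γ = (γ - β)⁻¹ • ((fun z => z e : (Sym2 V → ℝ) → ℝ) - β • 1) := by
    funext z
    simp [lf, div_eq_inv_mul]
  rw [this]
  exact Submodule.smul_mem _ _ (Submodule.sub_mem _ (rep_edge E e he)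
    (Submodule.smul_mem _ _ (rep_one E)))

def f1 (t : (Fin q × Fin q) × (Fin q × Fin q)) : (Sym2 (R ⊕ B) → ℝ) → ℝ :=
  if t.1.1 < t.1.2 ∧ t.2.1 ≠ t.2.2 ∧ D t.2.1 t.2.2 ≠ D t.1.1 t.1.2 then
    lf s(Sum.inl (core t.1.1 (cs hn t.2.1)), Sum.inl (core t.1.2 (cs hn t.2.2)))
      (D t.2.1 t.2.2) (D t.1.1 t.1.2) else 1

def E1 (t : (Fin q × Fin q) × (Fin q × Fin q)) : Set (Sym2 (R ⊕ B)) :=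
  {e | t.1.1 < t.1.2 ∧
    e = s(Sum.inl (core t.1.1 (cs hn t.2.1)), Sum.inl (core t.1.2 (cs hn t.2.2)))}

def f2 (t : Fin q × Fin q) : (Sym2 (R ⊕ B) → ℝ) → ℝ :=
  if D t.2 t.2 ≠ D t.1 t.1 then
    lf s(Sum.inl (core t.1 (cs hn t.2)), Sum.inl (core t.1 (Fin.last n)))
      (D t.2 t.2) (D t.1 t.1) else 1

def E2 (t : Fin q × Fin q) : Set (Sym2 (R ⊕ B)) :=
  {e | e = s(Sum.inl (core t.1 (cs hn t.2)), Sum.inl (core t.1 (Fin.last n)))}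

def f3 (t : R × Fin q) : (Sym2 (R ⊕ B) → ℝ) → ℝ :=
  if t.2 ≠ g t.1 ∧ (∀ i l, t.1 ≠ core i l) then
    lf s(Sum.inl t.1, Sum.inl (core (jj (g t.1) t.2) (cs hn t.2)))
      (D t.2 (jj (g t.1) t.2)) (D (g t.1) (jj (g t.1) t.2)) else 1

def E3 (t : R × Fin q) : Set (Sym2 (R ⊕ B)) :=
  {e | (∀ i l, t.1 ≠ core i l) ∧
    e = s(Sum.inl t.1, Sum.inl (core (jj (g t.1) t.2) (cs hn t.2)))}

def f4 (t : B × Fin (n + 1)) : (Sym2 (R ⊕ B) → ℝ) → ℝ := fun z =>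
  z s(Sum.inl (core (φ t.1).1.1 t.2), Sum.inr t.1) -
    z s(Sum.inl (core (φ t.1).1.2 (sh (φ t.1).2 t.2)), Sum.inr t.1)

def E4 (t : B × Fin (n + 1)) : Set (Sym2 (R ⊕ B)) :=
  {e | e = s(Sum.inl (core (φ t.1).1.1 t.2), Sum.inr t.1) ∨
    e = s(Sum.inl (core (φ t.1).1.2 (sh (φ t.1).2 t.2)), Sum.inr t.1)}

def bigF : (Sym2 (R ⊕ B) → ℝ) → ℝ :=
  (((∏ t, f1 D hn core t) * ∏ t, f2 D hn core t) * ∏ t, f3 D hn g core jj t) * ∏ t, f4 core φ t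

lemma cs_inj (i j : Fin q) (h : cs hn i = cs hn j) : i = j := by
  simp only [cs, Fin.mk.injEq] at h
  exact Fin.ext h

lemma cs_ne_last (i : Fin q) : cs hn i ≠ Fin.last n := by
  intro h
  have := congrArg Fin.val h
  simp [cs] at this
  omega

lemma f1_rep (t : (Fin q × Fin q) × (Fin q × Fin q)) :
    f1 (B := B) D hn core t ∈ MRep (E1 hn core t) := by
  unfold f1
  split_ifs with h
  · refine lf_rep (E1 hn core t) _ ?_ _ _
    exact ⟨h.1, rfl⟩
  · exact rep_one _

lemma f2_rep (t : Fin q × Fin q) :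
    f2 (B := B) D hn core t ∈ MRep (E2 hn core t) := by
  unfold f2
  split_ifs with h
  · refine lf_rep (E2 hn core t) _ ?_ _ _
    exact rfl
  · exact rep_one _

lemma f3_rep (t : R × Fin q) :
    f3 (B := B) D hn g core jj t ∈ MRep (E3 hn g core jj t) := by
  unfold f3
  split_ifs with h
  · refine lf_rep (E3 hn g core jj t) _ ?_ _ _
    exact ⟨h.2, rfl⟩
  · exact rep_one _

lemma f4_rep (t : B × Fin (n + 1)) : f4 core φ t ∈ MRep (E4 core φ t) := 
  Submodule.sub_mem _ (rep_edge _ _ (Or.inl rfl)) (rep_edge _ _ (Or.inr rfl))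

lemma bigF_rep (hinj : ∀ i j l k, core i l = core j k → i = j ∧ l = k)
    (hφ : ∀ y, (φ y).1.1 ≠ (φ y).1.2) :
    ∃ E : Set (Sym2 (R ⊕ B)), (∀ e ∈ E, ¬ e.IsDiag) ∧ bigF D hn g core jj φ ∈ MRep E := by
  have hcs := cs_inj hn
  have hcl := cs_ne_last hn
  have hsh := sh_inj (n := n)
  refine ⟨_, ?_, rep_mul ?_ (rep_mul ?_ (rep_mul ?_ (rep_prod' (E1 hn core) ?_ _ ?_)
    (rep_prod' (E2 hn core) ?_ _ ?_)) (rep_prod' (E3 hn g core jj) ?_ _ ?_))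
    (rep_prod' (E4 core φ) ?_ _ ?_)⟩
  · rintro e (((he | he) | he) | he)
    · obtain ⟨t, ht, rfl⟩ := Set.mem_iUnion.1 he
      simp only [Sym2.mk_isDiag_iff, Sum.inl.injEq]
      intro h
      exact ht.ne (hinj _ _ _ _ h).1
    · obtain ⟨t, rfl⟩ := Set.mem_iUnion.1 he
      simp only [Sym2.mk_isDiag_iff, Sum.inl.injEq]
      intro h
      exact hcl _ (hinj _ _ _ _ h).2
    · obtain ⟨t, ht, rfl⟩ := Set.mem_iUnion.1 he
      simp only [Sym2.mk_isDiag_iff, Sum.inl.injEq]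
      exact ht _ _
    · obtain ⟨t, rfl | rfl⟩ := Set.mem_iUnion.1 he <;> simp
  · rw [Set.disjoint_left]
    rintro e ((he | he) | he) he'
    · obtain ⟨t, ht, rfl⟩ := Set.mem_iUnion.1 he
      obtain ⟨t', h | h⟩ := Set.mem_iUnion.1 he' <;> simp at h
    · obtain ⟨t, rfl⟩ := Set.mem_iUnion.1 he
      obtain ⟨t', h | h⟩ := Set.mem_iUnion.1 he' <;> simp at h
    · obtain ⟨t, ht, rfl⟩ := Set.mem_iUnion.1 he
      obtain ⟨t', h | h⟩ := Set.mem_iUnion.1 he' <;> simp at h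
  · rw [Set.disjoint_left]
    rintro e (he | he) he'
    · obtain ⟨t, ht, rfl⟩ := Set.mem_iUnion.1 he
      obtain ⟨t', h', h⟩ := Set.mem_iUnion.1 he'
      simp only [Sym2.eq_iff, Sum.inl.injEq] at h
      rcases h with h | h
      · exact h' _ _ h.1.symm
      · exact h' _ _ h.2.symm
    · obtain ⟨t, rfl⟩ := Set.mem_iUnion.1 he
      obtain ⟨t', h', h⟩ := Set.mem_iUnion.1 he'
      simp only [Sym2.eq_iff, Sum.inl.injEq] at h
      rcases h with h | h
      · exact h' _ _ h.1.symm
      · exact h' _ _ h.2.symm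
  · rw [Set.disjoint_left]
    rintro e he he'
    obtain ⟨t, ht, rfl⟩ := Set.mem_iUnion.1 he
    obtain ⟨t', h⟩ := Set.mem_iUnion.1 he'
    simp only [E2, Set.mem_ofPred_eq, Sym2.eq_iff, Sum.inl.injEq] at h
    rcases h with h | h
    · exact ht.ne ((hinj _ _ _ _ h.1).1.trans (hinj _ _ _ _ h.2).1.symm)
    · exact ht.ne ((hinj _ _ _ _ h.1).1.trans (hinj _ _ _ _ h.2).1.symm)
  · intro t t' htt
    rw [Set.disjoint_left]
    rintro e ⟨ht, rfl⟩ ⟨ht', h⟩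
    simp only [Sym2.eq_iff, Sum.inl.injEq] at h
    rcases h with h | h
    · have h1 := hinj _ _ _ _ h.1
      have h2 := hinj _ _ _ _ h.2
      exact htt (Prod.ext (Prod.ext h1.1 h2.1) (Prod.ext (hcs _ _ h1.2) (hcs _ _ h2.2)))
    · have h1 := hinj _ _ _ _ h.1
      have h2 := hinj _ _ _ _ h.2
      rw [h1.1, h2.1] at ht
      exact lt_asymm ht ht'
  · exact f1_rep D hn core
  · intro t t' htt
    rw [Set.disjoint_left]
    rintro e rfl h
    simp only [E2, Set.mem_ofPred_eq, Sym2.eq_iff, Sum.inl.injEq] at h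
    rcases h with h | h
    · have h1 := hinj _ _ _ _ h.1
      exact htt (Prod.ext h1.1 (hcs _ _ h1.2))
    · exact hcl _ (hinj _ _ _ _ h.1).2
  · exact f2_rep D hn core
  · intro t t' htt
    rw [Set.disjoint_left]
    rintro e ⟨ht, rfl⟩ ⟨ht', h⟩
    simp only [Sym2.eq_iff, Sum.inl.injEq] at h
    rcases h with h | h
    · exact htt (Prod.ext h.1 (hcs _ _ (hinj _ _ _ _ h.2).2))
    · exact ht _ _ h.1
  · exact f3_rep D hn g core jj
  · rintro ⟨y, l⟩ ⟨y', l'⟩ htt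
    rw [Set.disjoint_left]
    intro e h h'
    simp only [E4, Set.mem_ofPred_eq] at h h'
    have hy := hφ y
    rcases h with rfl | rfl <;> rcases h' with h' | h' <;>
      simp only [Sym2.eq_iff, Sum.inl.injEq, Sum.inr.injEq, reduceCtorEq, and_false, false_and,
        or_false] at h' <;> obtain ⟨h1, rfl⟩ := h' <;> have h2 := hinj _ _ _ _ h1
    · exact htt (by rw [h2.2])
    · exact hy h2.1
    · exact hy h2.1.symm
    · exact htt (by rw [hsh _ _ _ h2.2])
  · exact f4_rep core φ

def gF (B : Type) [Fintype B] (U : GKernel) (x : R → I01) : ℝ :=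
  ((∏ t, f1 (B := B) D hn core t (zU U (Sum.elim x (fun _ : B => 0)))) *
    ∏ t, f2 (B := B) D hn core t (zU U (Sum.elim x (fun _ : B => 0)))) *
    ∏ t, f3 (B := B) D hn g core jj t (zU U (Sum.elim x (fun _ : B => 0)))

def jF (U : GKernel) (x : R → I01) (p : (Fin q × Fin q) × Bool) : ℝ :=
  ∫ y : I01, ∏ l : Fin (n + 1),
    (U.toFun (x (core p.1.1 l)) y - U.toFun (x (core p.1.2 (sh p.2 l))) y)

lemma bigF_int (U : GKernel) (x : R → I01) :
    ∫ y : B → I01, bigF D hn g core jj φ (zU U (Sum.elim x y)) =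
      gF D hn g core jj B U x * ∏ y, jF core U x (φ y) := by
  have : ∀ y : B → I01, bigF D hn g core jj φ (zU U (Sum.elim x y)) =
      gF D hn g core jj B U x * ∏ b, ∏ l : Fin (n + 1),
        (U.toFun (x (core (φ b).1.1 l)) (y b) -
          U.toFun (x (core (φ b).1.2 (sh (φ b).2 l))) (y b)) := by
    intro y
    rw [← Fintype.prod_prod_type' (fun (b : B) (l : Fin (n + 1)) =>
      (U.toFun (x (core (φ b).1.1 l)) (y b) -
          U.toFun (x (core (φ b).1.2 (sh (φ b).2 l))) (y b)))]
    simp only [bigF, gF, Pi.mul_apply, Finset.prod_apply]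
    congr 1
    congr 1
    · congr 1
      · refine Finset.prod_congr rfl fun t _ => ?_
        unfold f1
        split_ifs <;> rfl
      · refine Finset.prod_congr rfl fun t _ => ?_
        unfold f2
        split_ifs <;> rfl
    · refine Finset.prod_congr rfl fun t _ => ?_
      unfold f3
      split_ifs <;> rfl
  simp_rw [this]
  rw [integral_const_mul]
  congr 1
  exact integral_fintype_prod_volume_eq_prod (fun b (y : I01) => ∏ l : Fin (n + 1),
        (U.toFun (x (core (φ b).1.1 l)) y -
          U.toFun (x (core (φ b).1.2 (sh (φ b).2 l))) y))

end

lemma step_data {U : GKernel} {q : ℕ} {A : Fin q → Set I01} (hA : IsStepPartition U A) :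
    ∃ (τ : I01 → Fin q) (m : Fin q → Fin q → ℝ) (ρ : Fin q → I01),
      (∀ x i, x ∈ A i ↔ τ x = i) ∧ (∀ x y, U.toFun x y = m (τ x) (τ y)) ∧
      (∀ i, τ (ρ i) = i) ∧ (∀ i j, m i j = m j i) ∧
      (∀ i j v, PartDensityIs U A i j v ↔ m i j = v) := by
  obtain ⟨h1, h2, h3, h4, h5⟩ := hA
  have hx : ∀ x, ∃ i, x ∈ A i := fun x => by
    have : x ∈ ⋃ i, A i := by rw [h4]; trivial
    simpa using this
  choose τ hτ using hx
  choose m hm using h5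
  have hr : ∀ i, ∃ x, x ∈ A i := fun i => nonempty_of_measure_ne_zero (h2 i).ne'
  choose ρ hρ using hr
  have hA : ∀ x i, x ∈ A i ↔ τ x = i := by
    intro x i
    constructor
    · intro hx
      by_contra hne
      exact Set.disjoint_left.1 (h3 hne) (hτ x) hx
    · rintro rfl
      exact hτ x
  refine ⟨τ, m, ρ, hA, fun x y => hm _ _ x (hτ x) y (hτ y), fun i => (hA _ _).1 (hρ i), ?_, ?_⟩
  · intro i j
    rw [← hm i j _ (hρ i) _ (hρ j), U.symm', hm j i _ (hρ j) _ (hρ i)]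
  · intro i j v
    constructor
    · intro h
      rw [← hm i j _ (hρ i) _ (hρ j), h _ (hρ i) _ (hρ j)]
    · rintro rfl
      exact hm i j

lemma merge_parts {U : GKernel} {q : ℕ} {A : Fin q → Set I01} (hA : IsStepPartition U A)
    {τ : I01 → Fin q} {m : Fin q → Fin q → ℝ}
    (hτ : ∀ x i, x ∈ A i ↔ τ x = i) (hm : ∀ x y, U.toFun x y = m (τ x) (τ y))
    (hs : ∀ i j, m i j = m j i) {a b : Fin q} (hab : a ≠ b) (hrow : ∀ c, m a c = m b c) :
    HasStepPartition U (q - 1) := by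
  have hcard : Fintype.card {i : Fin q // i ≠ b} = q - 1 := by
    simp [Fintype.card_subtype_compl]
  let e : {i : Fin q // i ≠ b} ≃ Fin (q - 1) := Fintype.equivFinOfCardEq hcard
  let g : Fin q → Fin q := fun i => if i = b then a else i
  have hgb : ∀ i, g i ≠ b := by
    intro i
    simp only [g]
    split_ifs with h
    · exact hab
    · exact h
  have hgm : ∀ i j, m i j = m (g i) (g j) := by
    have h0 : ∀ i j, m i j = m (g i) j := by
      intro i j
      simp only [g]
      split_ifs with h
      · rw [hrow, h]
      · rfl
    intro i j
    rw [h0, hs, h0, hs]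
  refine ⟨fun c => ⋃ i ∈ {i : Fin q | g i = (e.symm c).1}, A i, ?_, ?_, ?_, ?_, ?_⟩
  · intro c
    exact MeasurableSet.biUnion (Set.to_countable _) fun i _ => hA.1 i
  · intro c
    refine lt_of_lt_of_le (hA.2.1 (e.symm c).1) (measure_mono ?_)
    refine Set.subset_biUnion_of_mem (u := A) ?_
    show g _ = _
    simp only [g]
    rw [if_neg (e.symm c).2]
  · intro c c' hcc
    rw [Set.disjoint_left]
    intro x hx hx'
    simp only [Set.mem_iUnion, hτ, exists_prop, exists_eq_right'] at hx hx'
    have hx : g (τ x) = _ := hx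
    have hx' : g (τ x) = _ := hx'
    exact hcc (e.symm.injective (Subtype.ext (hx.symm.trans hx')))
  · rw [Set.eq_univ_iff_forall]
    intro x
    simp only [Set.mem_iUnion, hτ, exists_prop, exists_eq_right']
    refine ⟨e ⟨g (τ x), hgb _⟩, ?_⟩
    show g (τ x) = _
    simp
  · intro c c'
    refine ⟨m (e.symm c).1 (e.symm c').1, fun x hx y hy => ?_⟩
    simp only [Set.mem_iUnion, hτ, exists_prop, exists_eq_right'] at hx hy
    have hx : g (τ x) = _ := hx
    have hy : g (τ y) = _ := hy
    rw [hm, hgm, hx, hy]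

def sF (U : GKernel) (n : ℕ) (u v : I01) : ℝ := ∫ y, (U.toFun u y - U.toFun v y) ^ (n + 1)

lemma sF_pos {U : GKernel} {q : ℕ} {A : Fin q → Set I01} (hA : IsStepPartition U A)
    {τ : I01 → Fin q} {m : Fin q → Fin q → ℝ}
    (hτ : ∀ x i, x ∈ A i ↔ τ x = i) (hm : ∀ x y, U.toFun x y = m (τ x) (τ y))
    {n : ℕ} (hn : Even (n + 1)) {u v : I01} {c : Fin q} (hc : m (τ u) c ≠ m (τ v) c) :
    0 < sF U n u v := by
  unfold sF
  obtain ⟨C, hC⟩ := U.bounded'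
  have hmeas : ∀ u, Measurable (fun y => U.toFun u y) := fun u =>
    U.measurable'.comp (measurable_const.prodMk measurable_id)
  rw [integral_pos_iff_support_of_nonneg]
  · refine lt_of_lt_of_le (hA.2.1 c) (measure_mono ?_)
    intro y hy
    have := (hτ _ _).1 hy
    rw [Function.mem_support]
    apply pow_ne_zero
    rw [hm, hm, this]
    exact sub_ne_zero.2 hc
  · intro y
    exact hn.pow_nonneg _
  · refine Integrable.of_bound (C := (C + C) ^ (n + 1)) ?_ ?_
    · exact (((hmeas u).sub (hmeas v)).pow_const _).aestronglyMeasurable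
    · refine Filter.Eventually.of_forall fun y => ?_
      rw [norm_pow]
      refine pow_le_pow_left₀ (norm_nonneg _) ?_ _
      exact (norm_sub_le _ _).trans (add_le_add (hC _ _) (hC _ _))

section
variable {q n : ℕ} (D : Matrix (Fin q) (Fin q) ℝ) (hn : q ≤ n) {R : Type} [Fintype R]
  (g : R → Fin q) (core : Fin q → Fin (n + 1) → R) (jj : Fin q → Fin q → Fin q)
  (B : Type) [Fintype B] (U : GKernel) (x : R → I01) {τ : I01 → Fin q} {m : Fin q → Fin q → ℝ}

lemma gF_good (hg : ∀ i l, g (core i l) = i) (hm : ∀ x y, U.toFun x y = m (τ x) (τ y))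
    (hjj : ∀ i k, k ≠ i → D i (jj i k) ≠ D k (jj i k))
    (π : Fin q → Fin q) (hx : ∀ v, τ (x v) = π (g v)) (hD : ∀ i j, m (π i) (π j) = D i j) :
    gF D hn g core jj B U x = 1 := by
  have hU : ∀ u v, U.toFun (x u) (x v) = D (g u) (g v) := by
    intro u v
    rw [hm, hx, hx, hD]
  unfold gF
  rw [Finset.prod_eq_one, Finset.prod_eq_one, Finset.prod_eq_one]
  · norm_num
  · intro t _
    unfold f3
    split_ifs with h
    · show (U.toFun (x _) (x _) - _) / _ = 1
      rw [hU, hg]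
      exact div_self (sub_ne_zero.2 (hjj _ _ h.1))
    · rfl
  · intro t _
    unfold f2
    split_ifs with h
    · show (U.toFun (x _) (x _) - _) / _ = 1
      rw [hU, hg, hg]
      exact div_self (sub_ne_zero.2 (Ne.symm h))
    · rfl
  · intro t _
    unfold f1
    split_ifs with h
    · show (U.toFun (x _) (x _) - _) / _ = 1
      rw [hU, hg, hg]
      exact div_self (sub_ne_zero.2 (Ne.symm h.2.2))
    · rfl

lemma gF_bad (hm : ∀ x y, U.toFun x y = m (τ x) (τ y)) (hms : ∀ i j, m i j = m j i)
    (hDs : ∀ i j, D i j = D j i)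
    (hjj : ∀ i k, k ≠ i → D i (jj i k) ≠ D k (jj i k))
    (hd : ∀ i, ∃ i', m i i = D i' i') (ho : ∀ i j, i ≠ j → ∃ i' j', i' ≠ j' ∧ m i j = D i' j')
    (p : Fin q → Fin q) (hp : Function.Bijective p)
    (hg : ∀ i l, g (core i l) = i)
    (hcore : ∀ i l, τ (x (core i l)) = p i) (hne : gF D hn g core jj B U x ≠ 0) :
    (∀ v, τ (x v) = p (g v)) ∧ ∀ i j, m (p i) (p j) = D i j := by
  unfold gF at hne
  have h3 := right_ne_zero_of_mul hne
  have h12 := left_ne_zero_of_mul hne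
  have h2 := right_ne_zero_of_mul h12
  have h1 := left_ne_zero_of_mul h12
  rw [Finset.prod_ne_zero_iff] at h1 h2 h3
  have hlt : ∀ i j, i < j → m (p i) (p j) = D i j := by
    intro i j hij
    obtain ⟨i', j', hne', he⟩ := ho (p i) (p j) (fun h => hij.ne (hp.1 h))
    by_contra hcon
    rw [he] at hcon
    apply h1 ((i, j), (i', j')) (Finset.mem_univ _)
    unfold f1
    rw [if_pos ⟨hij, hne', hcon⟩]
    show (U.toFun (x _) (x _) - _) / _ = 0
    rw [hm, hcore, hcore, he, sub_self, zero_div]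
  have hall : ∀ i j, m (p i) (p j) = D i j := by
    intro i j
    rcases lt_trichotomy i j with h | rfl | h
    · exact hlt i j h
    · obtain ⟨i', he⟩ := hd (p i)
      by_contra hcon
      rw [he] at hcon
      apply h2 (i, i') (Finset.mem_univ _)
      unfold f2
      rw [if_pos hcon]
      show (U.toFun (x _) (x _) - _) / _ = 0
      rw [hm, hcore, hcore, he, sub_self, zero_div]
    · rw [hms, hDs, hlt j i h]
  refine ⟨fun v => ?_, hall⟩
  by_cases hv : ∀ i l, v ≠ core i l
  · obtain ⟨k, hk⟩ := hp.2 (τ (x v))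
    by_contra hcon
    have hki : k ≠ g v := by
      rintro rfl
      exact hcon hk.symm
    apply h3 (v, k) (Finset.mem_univ _)
    unfold f3
    rw [if_pos ⟨hki, hv⟩]
    show (U.toFun (x _) (x _) - _) / _ = 0
    rw [hm, hcore, ← hk, hall, sub_self, zero_div]
  · push Not at hv
    obtain ⟨i, l, rfl⟩ := hv
    rw [hcore, hg]


lemma jF_zero (hm : ∀ x y, U.toFun x y = m (τ x) (τ y)) (i j : Fin q) (ε : Bool)
    (l : Fin (n + 1)) (h : τ (x (core i l)) = τ (x (core j (sh ε l)))) :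
    jF core U x ((i, j), ε) = 0 := by
  unfold jF
  rw [← integral_zero I01 ℝ]
  congr 1
  funext y
  apply Finset.prod_eq_zero (Finset.mem_univ l)
  simp only [hm, h, sub_self]

lemma jF_good (hm : ∀ x y, U.toFun x y = m (τ x) (τ y)) (ρ : Fin q → I01) (hρ : ∀ i, τ (ρ i) = i)
    (π : Fin q → Fin q) (hx : ∀ i l, τ (x (core i l)) = π i) (p : (Fin q × Fin q) × Bool) :
    jF core U x p = sF U n (ρ (π p.1.1)) (ρ (π p.1.2)) := by
  unfold jF sF
  congr 1
  funext y
  simp only [hm, hx, hρ]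
  simp

lemma core_const (hm : ∀ x y, U.toFun x y = m (τ x) (τ y))
    (hJ : ∀ i j ε, i ≠ j → jF core U x ((i, j), ε) ≠ 0) :
    ∃ p : Fin q → Fin q, Function.Bijective p ∧ ∀ i l, τ (x (core i l)) = p i := by
  have h0 : ∀ i j l, i ≠ j → τ (x (core i l)) ≠ τ (x (core j l)) := by
    intro i j l hij h
    exact hJ i j false hij (jF_zero core U x hm i j false l h)
  have h1 : ∀ i j l, i ≠ j → τ (x (core i l)) ≠ τ (x (core j (l + 1))) := by
    intro i j l hij h
    exact hJ i j true hij (jF_zero core U x hm i j true l h)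
  have hb : ∀ l, Function.Bijective (fun i => τ (x (core i l))) := by
    intro l
    refine Finite.injective_iff_bijective.1 fun i j h => ?_
    by_contra hij
    exact h0 i j l hij h
  refine ⟨fun i => τ (x (core i 0)), hb 0, fun i l => ?_⟩
  induction l using Fin.induction with
  | zero => rfl
  | succ l ih =>
    rw [← ih, ← Fin.coeSucc_eq_succ]
    obtain ⟨j, hj⟩ := (hb l.castSucc).2 (τ (x (core i (l.castSucc + 1))))
    have hji : j = i := by
      by_contra hne
      exact h1 j i _ hne hj
    rw [← hj, hji]

end

lemma card_aux (q : ℕ) (hq : 2 ≤ q) :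
    Fintype.card ({p : Fin q × Fin q // p.1 ≠ p.2} × Bool) = 2 * q * (q - 1) := by
  have h : (Finset.univ.filter fun p : Fin q × Fin q => p.1 ≠ p.2) =
      (Finset.univ : Finset (Fin q)).offDiag := by
    ext p
    simp
  rw [Fintype.card_prod, Fintype.card_subtype, h, Finset.offDiag_card]
  simp
  obtain ⟨k, rfl⟩ : ∃ k, q = k + 1 := ⟨q - 1, by omega⟩
  rw [show (k + 1) * (k + 1) - (k + 1) = (k + 1) * k by
    rw [Nat.mul_succ (k + 1) k]; omega]
  simp
  ring

theorem statement9 (q : ℕ) (hq : 2 ≤ q) (D : Matrix (Fin q) (Fin q) ℝ)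
    (hD : D.IsSymm) :
    ∃ (m : (Fin q → ℕ) → ℕ)
      (H : (s : Fin q → ℕ) → Fin (m s) →
        SimpleGraph (((i : Fin q) × Fin (s i)) ⊕ Fin (2 * q * (q - 1))))
      (c : (s : Fin q → ℕ) → Fin (m s) → ℝ),
      ∀ (U : GKernel) (A : Fin q → Set I01),
        IsStepPartition U A → ¬ HasStepPartition U (q - 1) →
        (∀ i : Fin q, ∃ i' : Fin q, PartDensityIs U A i i (D i' i')) →
        (∀ i j : Fin q, i ≠ j → ∃ i' j' : Fin q, i' ≠ j' ∧ PartDensityIs U A i j (D i' j')) →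
        ∃ c₀ : ℝ, c₀ ≠ 0 ∧
          ∀ s : Fin q → ℕ, (∀ i, q + 2 ≤ s i ∧ s i ≤ 2 * q + 2) →
            ∀ᵐ x ∂(volume : Measure (((i : Fin q) × Fin (s i)) → I01)),
              (∑ t, c s t * rootedDensity (H s t) U x = 0 ∨
                ∑ t, c s t * rootedDensity (H s t) U x = c₀) ∧
              ((∑ t, c s t * rootedDensity (H s t) U x) ≠ 0 ↔
                ∃ π : Equiv.Perm (Fin q),
                  (∀ v : (i : Fin q) × Fin (s i), x v ∈ A (π v.1)) ∧
                  (∀ i : Fin q, PartDensityIs U A (π i) (π i) (D i i)) ∧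
                  (∀ i j : Fin q, i ≠ j →
                    PartDensityIs U A (π i) (π j) (D i j))) := by
  by_cases hrows : ∃ i k, i ≠ k ∧ ∀ c, D i c = D k c
  · obtain ⟨i, k, hik, hrow⟩ := hrows
    refine ⟨fun _ => 0, fun _ t => t.elim0, fun _ t => t.elim0, ?_⟩
    intro U A hA hmin hd ho
    refine ⟨1, one_ne_zero, fun s hs => Filter.Eventually.of_forall fun x => ?_⟩
    simp only [Finset.univ_eq_empty, Finset.sum_empty, true_or, ne_eq, not_true_eq_false,
      false_iff, true_and]
    rintro ⟨π, -, h1, h2⟩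
    obtain ⟨τ, m, ρ, hτ, hm, hρ, hs, hP⟩ := step_data hA
    have hall : ∀ i j, m (π i) (π j) = D i j := by
      intro i j
      by_cases hij : i = j
      · subst hij
        exact (hP _ _ _).1 (h1 i)
      · exact (hP _ _ _).1 (h2 i j hij)
    apply hmin
    refine merge_parts hA hτ hm hs (a := π i) (b := π k) (fun h => hik (π.injective h)) ?_
    intro c
    obtain ⟨c, rfl⟩ := π.surjective c
    rw [hall, hall, hrow]
  push Not at hrows
  have hrows' : ∀ i k, ∃ c, k ≠ i → D i c ≠ D k c := by
    intro i k
    by_cases h : k = i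
    · exact ⟨i, fun h' => absurd h h'⟩
    · obtain ⟨c, hc⟩ := hrows i k (Ne.symm h)
      exact ⟨c, fun _ => hc⟩
  choose jj hjj using hrows'
  obtain ⟨n, hn, hn2, hev⟩ : ∃ n, q ≤ n ∧ n + 1 ≤ q + 2 ∧ Even (n + 1) := by
    rcases Nat.even_or_odd q with h | h
    · exact ⟨q + 1, by omega, by omega, by rw [add_assoc]; exact h.add (by decide)⟩
    · exact ⟨q, le_rfl, by omega, h.add_one⟩
  let φ : Fin (2 * q * (q - 1)) ≃ {p : Fin q × Fin q // p.1 ≠ p.2} × Bool :=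
    (Fintype.equivFinOfCardEq (card_aux q hq)).symm
  let φ' : Fin (2 * q * (q - 1)) → (Fin q × Fin q) × Bool := fun y => ((φ y).1.1, (φ y).2)
  have hφ' : ∀ y, (φ' y).1.1 ≠ (φ' y).1.2 := fun y => (φ y).1.2
  let core : (s : Fin q → ℕ) → (∀ i, q + 2 ≤ s i) → Fin q → Fin (n + 1) →
      ((i : Fin q) × Fin (s i)) := fun s hs i l =>
    ⟨i, ⟨l.1, lt_of_lt_of_le l.2 (hn2.trans (hs i))⟩⟩
  have hinj : ∀ s hs i j l k, core s hs i l = core s hs j k → i = j ∧ l = k := by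
    intro s hs i j l k h
    simp only [core, Sigma.mk.injEq] at h
    obtain ⟨rfl, h⟩ := h
    have h' := eq_of_heq h
    rw [Fin.mk.injEq] at h'
    exact ⟨rfl, Fin.ext h'⟩
  have hex : ∀ s : Fin q → ℕ, ∃ (m : ℕ)
      (H : Fin m → SimpleGraph (((i : Fin q) × Fin (s i)) ⊕ Fin (2 * q * (q - 1))))
      (c : Fin m → ℝ), ∀ hs : ∀ i, q + 2 ≤ s i, ∀ U x,
        ∑ t, c t * rootedDensity (H t) U x =
          gF D hn Sigma.fst (core s hs) jj (Fin (2 * q * (q - 1))) U x *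
            ∏ y, jF (core s hs) U x (φ' y) := by
    intro s
    by_cases hs : ∀ i, q + 2 ≤ s i
    · obtain ⟨E, hE, hF⟩ := bigF_rep (R := (i : Fin q) × Fin (s i)) D hn Sigma.fst (core s hs) jj φ'
        (hinj s hs) hφ'
      obtain ⟨m, H, c, h⟩ := rep_extract hE hF
      refine ⟨m, H, c, fun _ U x => ?_⟩
      rw [sum_rooted H c U x _ h, bigF_int]
    · exact ⟨0, fun t => t.elim0, fun t => t.elim0, fun h => absurd h hs⟩
  choose M H c hval using hex
  refine ⟨M, H, c, ?_⟩
  intro U A hA hmin hd ho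
  obtain ⟨τ, m, ρ, hτ, hm, hρ, hms, hP⟩ := step_data hA
  simp only [hP] at hd ho
  refine ⟨∏ p : {p : Fin q × Fin q // p.1 ≠ p.2} × Bool, sF U n (ρ p.1.1.1) (ρ p.1.1.2), ?_, ?_⟩
  · rw [Finset.prod_ne_zero_iff]
    intro p _
    have : ∃ c, m p.1.1.1 c ≠ m p.1.1.2 c := by
      by_contra hcon
      push Not at hcon
      exact hmin (merge_parts hA hτ hm hms p.1.2 hcon)
    obtain ⟨c, hc⟩ := this
    refine (sF_pos hA hτ hm hev (c := c) ?_).ne'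
    rwa [hρ, hρ]
  · intro s hs
    refine Filter.Eventually.of_forall fun x => ?_
    have hs' : ∀ i, q + 2 ≤ s i := fun i => (hs i).1
    rw [hval s hs' U x]
    have hg : ∀ i l, (core s hs' i l).1 = i := fun _ _ => rfl
    have fwd : gF D hn Sigma.fst (core s hs') jj (Fin (2 * q * (q - 1))) U x *
            ∏ y, jF (core s hs') U x (φ' y) ≠ 0 → ∃ π : Equiv.Perm (Fin q),
        (∀ v : (i : Fin q) × Fin (s i), τ (x v) = π v.1) ∧ ∀ i j, m (π i) (π j) = D i j := by
      intro hne
      have hG := left_ne_zero_of_mul hne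
      have hJ := right_ne_zero_of_mul hne
      rw [Finset.prod_ne_zero_iff] at hJ
      obtain ⟨p, hp, hcore⟩ := core_const (core s hs') U x hm (by
        intro i j ε hij
        have := hJ (φ.symm (⟨(i, j), hij⟩, ε)) (Finset.mem_univ _)
        simpa [φ'] using this)
      obtain ⟨h1, h2⟩ := gF_bad D hn Sigma.fst (core s hs') jj _ U x hm hms
        (fun i j => hD.apply j i) hjj hd ho p hp hg hcore hG
      exact ⟨Equiv.ofBijective p hp, h1, h2⟩
    have bwd : (∃ π : Equiv.Perm (Fin q),
        (∀ v : (i : Fin q) × Fin (s i), τ (x v) = π v.1) ∧ ∀ i j, m (π i) (π j) = D i j) →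
        gF D hn Sigma.fst (core s hs') jj (Fin (2 * q * (q - 1))) U x *
            ∏ y, jF (core s hs') U x (φ' y) =
        ∏ p : {p : Fin q × Fin q // p.1 ≠ p.2} × Bool, sF U n (ρ p.1.1.1) (ρ p.1.1.2) := by
      rintro ⟨π, h1, h2⟩
      rw [gF_good D hn Sigma.fst (core s hs') jj _ U x hg hm hjj π h1 h2, one_mul]
      let e : {p : Fin q × Fin q // p.1 ≠ p.2} ≃ {p : Fin q × Fin q // p.1 ≠ p.2} :=
        Equiv.subtypeEquiv (Equiv.prodCongr π π) (by simp)
      refine Fintype.prod_equiv (φ.trans (Equiv.prodCongr e (Equiv.refl Bool))) _ _ fun y => ?_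
      rw [jF_good (core s hs') U x hm ρ hρ π (fun i l => h1 _)]
      rfl
    have key : (∃ π : Equiv.Perm (Fin q),
        (∀ v : (i : Fin q) × Fin (s i), τ (x v) = π v.1) ∧ ∀ i j, m (π i) (π j) = D i j) ↔
        ∃ π : Equiv.Perm (Fin q),
                  (∀ v : (i : Fin q) × Fin (s i), x v ∈ A (π v.1)) ∧
                  (∀ i : Fin q, PartDensityIs U A (π i) (π i) (D i i)) ∧
                  (∀ i j : Fin q, i ≠ j →
                    PartDensityIs U A (π i) (π j) (D i j)) := by
      refine exists_congr fun π => and_congr (by simp only [hτ]) ?_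
      simp only [hP]
      constructor
      · exact fun h => ⟨fun i => h i i, fun i j _ => h i j⟩
      · rintro ⟨ha, hb⟩ i j
        by_cases hij : i = j
        · subst hij
          exact ha i
        · exact hb i j hij
    rw [← key]
    refine ⟨?_, fwd, fun h => ?_⟩
    · by_cases h : gF D hn Sigma.fst (core s hs') jj (Fin (2 * q * (q - 1))) U x *
            ∏ y, jF (core s hs') U x (φ' y) = 0
      · exact Or.inl h
      · exact Or.inr (bwd (fwd h))
    · rw [bwd h]
      rw [Finset.prod_ne_zero_iff]
      intro p _
      have : ∃ c, m p.1.1.1 c ≠ m p.1.1.2 c := by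
        by_contra hcon
        push Not at hcon
        exact hmin (merge_parts hA hτ hm hms p.1.2 hcon)
      obtain ⟨c, hc⟩ := this
      refine (sF_pos hA hτ hm hev (c := c) ?_).ne'
      rwa [hρ, hρ]

end
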